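/- Let G be a Garside group and let x ∈ SSS(x) ⊆ G with inf(x) = p and ℓ(x) > 1. Suppose x is conjugate to a left rigid element, and let m be such that y = c_L^m(x) is left rigid. Let C_i = ι_L(c_L^{i−1}(x)) for i ≥ 1. Then C₁⋯C_m = (x^m Δ^{−mp}) ∧_L Δ^m, and moreover inf(C₁⋯C_m) = 0 and sup(C₁⋯C_m) = m. -/

import Mathlib

/-!
Axiomatization of Garside groups (positive cone, Garside element, lattice
structure, left/right normal forms), following the paper
"On the cycling operation in braid groups" by Gebhardt and González-Meneses.
-/

namespace Garside

variable {G : Type*} [Group G]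

/-- `a ≼ b`: `a` is a left divisor (prefix) of `b` w.r.t. the positive cone `P`. -/
def LeftDvd (P : Submonoid G) (a b : G) : Prop := a⁻¹ * b ∈ P

/-- `a` is a right divisor (suffix) of `b` w.r.t. the positive cone `P`
(i.e. `b ≽ a` in the notation of the paper). -/
def RightDvd (P : Submonoid G) (a b : G) : Prop := b * a⁻¹ ∈ P

/-- A simple element: a positive prefix of `Δ`. -/
def Simple (P : Submonoid G) (Δ : G) (s : G) : Prop := s ∈ P ∧ LeftDvd P s Δ

/-- An atom: a nontrivial positive element which is not the product
of two nontrivial positive elements. -/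
def Atom (P : Submonoid G) (a : G) : Prop :=
  a ∈ P ∧ a ≠ 1 ∧ ∀ b c : G, b ∈ P → c ∈ P → a = b * c → b = 1 ∨ c = 1

/-- `Δ^p x₁ ⋯ x_r` (with `l = [x₁,…,x_r]`) is the left normal form of `x`:
each factor is a proper simple element and consecutive factors are
left-weighted, `x_i = (x_i x_{i+1}) ∧_L Δ`. -/
def IsLeftNF (P : Submonoid G) (Δ : G) (gcdL : G → G → G) (p : ℤ) (l : List G) (x : G) :
    Prop :=
  x = Δ ^ p * l.prod ∧ (∀ s ∈ l, Simple P Δ s ∧ s ≠ 1 ∧ s ≠ Δ) ∧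
    l.Chain' (fun s t => gcdL (s * t) Δ = s)

/-- `y₁ ⋯ y_r Δ^p` (with `l = [y₁,…,y_r]`) is the right normal form of `x`:
each factor is a proper simple element and consecutive factors are
right-weighted, `y_{i+1} = (y_i y_{i+1}) ∧_R Δ`. -/
def IsRightNF (P : Submonoid G) (Δ : G) (gcdR : G → G → G) (p : ℤ) (l : List G) (x : G) :
    Prop :=
  x = l.prod * Δ ^ p ∧ (∀ s ∈ l, Simple P Δ s ∧ s ≠ 1 ∧ s ≠ Δ) ∧
    l.Chain' (fun s t => gcdR (s * t) Δ = t)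

/-- A Garside structure on a group `G`: a positive cone which induces lattice
orders by left and right divisibility, and a Garside element `Δ` whose left and
right divisors coincide (the simple elements), generate the group, and such that
every element admits a unique left and right normal form. -/
structure GarsideGroup (G : Type*) [Group G] where
  pos : Submonoid G
  pos_antisymm : ∀ a : G, a ∈ pos → a⁻¹ ∈ pos → a = 1
  Δ : G
  Δ_pos : Δ ∈ pos
  gcdL : G → G → G
  gcdL_dvd_left : ∀ a b : G, LeftDvd pos (gcdL a b) a
  gcdL_dvd_right : ∀ a b : G, LeftDvd pos (gcdL a b) b
  dvd_gcdL : ∀ a b c : G, LeftDvd pos c a → LeftDvd pos c b → LeftDvd pos c (gcdL a b)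
  lcmL : G → G → G
  dvd_lcmL_left : ∀ a b : G, LeftDvd pos a (lcmL a b)
  dvd_lcmL_right : ∀ a b : G, LeftDvd pos b (lcmL a b)
  lcmL_dvd : ∀ a b c : G, LeftDvd pos a c → LeftDvd pos b c → LeftDvd pos (lcmL a b) c
  gcdR : G → G → G
  gcdR_dvd_left : ∀ a b : G, RightDvd pos (gcdR a b) a
  gcdR_dvd_right : ∀ a b : G, RightDvd pos (gcdR a b) b
  dvd_gcdR : ∀ a b c : G, RightDvd pos c a → RightDvd pos c b → RightDvd pos c (gcdR a b)
  lcmR : G → G → G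
  dvd_lcmR_left : ∀ a b : G, RightDvd pos a (lcmR a b)
  dvd_lcmR_right : ∀ a b : G, RightDvd pos b (lcmR a b)
  lcmR_dvd : ∀ a b c : G, RightDvd pos a c → RightDvd pos b c → RightDvd pos (lcmR a b) c
  divisors_Δ : ∀ s : G, (s ∈ pos ∧ LeftDvd pos s Δ) ↔ (s ∈ pos ∧ RightDvd pos s Δ)
  simples_generate : Subgroup.closure {s : G | Simple pos Δ s} = ⊤
  lnf_exists : ∀ x : G, ∃ pl : ℤ × List G, IsLeftNF pos Δ gcdL pl.1 pl.2 x
  lnf_unique : ∀ (x : G) (p q : ℤ) (l m : List G),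
    IsLeftNF pos Δ gcdL p l x → IsLeftNF pos Δ gcdL q m x → p = q ∧ l = m
  rnf_exists : ∀ x : G, ∃ pl : ℤ × List G, IsRightNF pos Δ gcdR pl.1 pl.2 x
  rnf_unique : ∀ (x : G) (p q : ℤ) (l m : List G),
    IsRightNF pos Δ gcdR p l x → IsRightNF pos Δ gcdR q m x → p = q ∧ l = m
  lnf_rnf_agree : ∀ (x : G) (p q : ℤ) (l m : List G),
    IsLeftNF pos Δ gcdL p l x → IsRightNF pos Δ gcdR q m x → p = q ∧ l.length = m.length

/-- `L` is the left lcm of the set `S`. -/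
def IsLcmL (P : Submonoid G) (S : Set G) (L : G) : Prop :=
  (∀ a ∈ S, LeftDvd P a L) ∧ ∀ c : G, (∀ a ∈ S, LeftDvd P a c) → LeftDvd P L c

/-- A Garside group is atom-friendly (on the left) if `Δ` is the left lcm of the
set of atoms and the starting set of the left lcm of any set `B` of atoms is `B`. -/
def AtomFriendlyL (𝒢 : GarsideGroup G) : Prop :=
  IsLcmL 𝒢.pos {a : G | Atom 𝒢.pos a} 𝒢.Δ ∧
    ∀ B : Set G, B ⊆ {a : G | Atom 𝒢.pos a} →
      ∃ L : G, IsLcmL 𝒢.pos B L ∧ {a : G | Atom 𝒢.pos a ∧ LeftDvd 𝒢.pos a L} = B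

namespace GarsideGroup

variable (𝒢 : GarsideGroup G)

/-- The left normal form of `x`, as a pair (infimum, list of factors). -/
noncomputable def lnf (x : G) : ℤ × List G := Classical.choose (𝒢.lnf_exists x)

/-- The right normal form of `x`, as a pair (exponent of `Δ`, list of factors). -/
noncomputable def rnf (x : G) : ℤ × List G := Classical.choose (𝒢.rnf_exists x)

/-- `inf x = p`, the maximal `p` with `Δ^p ≼ x`. -/
noncomputable def inf (x : G) : ℤ := (𝒢.lnf x).1

/-- The canonical length `ℓ(x) = r`. -/
noncomputable def len (x : G) : ℕ := (𝒢.lnf x).2.length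

/-- `sup x = p + r`. -/
noncomputable def sup (x : G) : ℤ := 𝒢.inf x + 𝒢.len x

/-- `tau 𝒢 k x = τ^k(x) = Δ^{-k} x Δ^k`. -/
def tau (k : ℤ) (x : G) : G := 𝒢.Δ ^ (-k) * x * 𝒢.Δ ^ k

/-- The left initial factor `ι_L(x) = τ^{-p}(x₁)` (equal to `1` if `ℓ(x) = 0`). -/
noncomputable def iotaL (x : G) : G := 𝒢.tau (-(𝒢.lnf x).1) ((𝒢.lnf x).2.headD 1)

/-- The right initial factor `ι_R(x) = τ^{p}(y_r)` (equal to `1` if `ℓ(x) = 0`). -/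
noncomputable def iotaR (x : G) : G := 𝒢.tau (𝒢.rnf x).1 (((𝒢.rnf x).2.getLast?).getD 1)

/-- Left cycling: `c_L(x) = ι_L(x)⁻¹ · x · ι_L(x)`. -/
noncomputable def cL (x : G) : G := (𝒢.iotaL x)⁻¹ * x * 𝒢.iotaL x

/-- Right cycling: `c_R(x) = ι_R(x) · x · ι_R(x)⁻¹`. -/
noncomputable def cR (x : G) : G := 𝒢.iotaR x * x * (𝒢.iotaR x)⁻¹

/-- `x = Δ^p x₁⋯x_r` (in left normal form, `r > 0`) is left rigid if
`Δ^p x₁⋯x_r ι_L(x)` is in left normal form as written. -/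
def LeftRigid (x : G) : Prop :=
  (𝒢.lnf x).2 ≠ [] ∧
    IsLeftNF 𝒢.pos 𝒢.Δ 𝒢.gcdL (𝒢.lnf x).1 ((𝒢.lnf x).2 ++ [𝒢.iotaL x]) (x * 𝒢.iotaL x)

/-- `x = y₁⋯y_r Δ^p` (in right normal form, `r > 0`) is right rigid if
`ι_R(x) y₁⋯y_r Δ^p` is in right normal form as written. -/
def RightRigid (x : G) : Prop :=
  (𝒢.rnf x).2 ≠ [] ∧
    IsRightNF 𝒢.pos 𝒢.Δ 𝒢.gcdR (𝒢.rnf x).1 (𝒢.iotaR x :: (𝒢.rnf x).2) (𝒢.iotaR x * x)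

/-- The super summit set: conjugates of minimal canonical length. -/
def SSS (x : G) : Set G :=
  {y | IsConj x y ∧ ∀ z : G, IsConj x z → 𝒢.len y ≤ 𝒢.len z}

/-- The left ultra summit set. -/
def USSL (x : G) : Set G :=
  {y ∈ 𝒢.SSS x | ∃ t : ℕ, 1 ≤ t ∧ (𝒢.cL)^[t] y = y}

/-- The right ultra summit set. -/
def USSR (x : G) : Set G :=
  {y ∈ 𝒢.SSS x | ∃ t : ℕ, 1 ≤ t ∧ (𝒢.cR)^[t] y = y}

/-- `x` is periodically geodesic: `inf(x^m) = m inf(x)` and `sup(x^m) = m sup(x)`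
for all `m ≥ 1`. -/
def PeriodicallyGeodesic (x : G) : Prop :=
  ∀ m : ℕ, 1 ≤ m → 𝒢.inf (x ^ m) = (m : ℤ) * 𝒢.inf x ∧ 𝒢.sup (x ^ m) = (m : ℤ) * 𝒢.sup x

/-- The left interior `x°_L = x Δ^{-p}`, where `p = inf(x)`. -/
noncomputable def intL (x : G) : G := x * 𝒢.Δ ^ (-𝒢.inf x)

/-- The right interior `x°_R = Δ^{-p} x`, where `p = inf(x)`. -/
noncomputable def intR (x : G) : G := 𝒢.Δ ^ (-𝒢.inf x) * x

/-- The right transport of `v` (where `v x v⁻¹ = z`):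
`v^{(1)}_R = ι_R(z) · v · ι_R(x)⁻¹`. -/
noncomputable def transR (x v : G) : G := 𝒢.iotaR (v * x * v⁻¹) * v * (𝒢.iotaR x)⁻¹

/-- The iterated right transport `v^{(i)}_R` of `v` along the right cyclings of `x`. -/
noncomputable def transRIter (x : G) : ℕ → G → G
  | 0, v => v
  | i + 1, v => 𝒢.transR ((𝒢.cR)^[i] x) (transRIter x i v)

/-- Arrows of the left ultra summit graph `USG_L(x)`: triples `(u, s, v)` with
`u, v ∈ USS_L(x)`, `s` simple and `s⁻¹ u s = v`. -/
def ArrL (x : G) : Set (G × G × G) :=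
  {a | a.1 ∈ 𝒢.USSL x ∧ a.2.2 ∈ 𝒢.USSL x ∧ Simple 𝒢.pos 𝒢.Δ a.2.1 ∧
    a.2.1⁻¹ * a.1 * a.2.1 = a.2.2}

/-- Arrows of the right ultra summit graph `USG_R(x)`: triples `(u, s, v)` with
`u, v ∈ USS_R(x)`, `s` simple and `s u s⁻¹ = v`. -/
def ArrR (x : G) : Set (G × G × G) :=
  {a | a.1 ∈ 𝒢.USSR x ∧ a.2.2 ∈ 𝒢.USSR x ∧ Simple 𝒢.pos 𝒢.Δ a.2.1 ∧
    a.2.1 * a.1 * a.2.1⁻¹ = a.2.2}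

/-- `PathFrom A u l`: the list of arrows `l` forms a directed path in the
graph with arrow set `A`, starting at the vertex `u`. -/
def PathFrom (A : Set (G × G × G)) : G → List (G × G × G) → Prop
  | _, [] => True
  | u, a :: rest => a ∈ A ∧ a.1 = u ∧ PathFrom A a.2.2 rest

/-- Minimal arrows of `USG_L(x)`: arrows whose label is not a product of the
labels of a directed path of length at least 2 starting at the same vertex. -/
def MinArrL (x : G) : Set (G × G × G) :=
  {a | a ∈ 𝒢.ArrL x ∧ ¬ ∃ l : List (G × G × G), 2 ≤ l.length ∧
    PathFrom (𝒢.ArrL x) a.1 l ∧ (l.map (fun b => b.2.1)).prod = a.2.1}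

/-- Minimal arrows of `USG_R(x)`. -/
def MinArrR (x : G) : Set (G × G × G) :=
  {a | a ∈ 𝒢.ArrR x ∧ ¬ ∃ l : List (G × G × G), 2 ≤ l.length ∧
    PathFrom (𝒢.ArrR x) a.1 l ∧ (l.map (fun b => b.2.1)).prod = a.2.1}

end GarsideGroup

end Garside

namespace Garside

namespace GarsideGroup

section helpers

variable {G : Type*} [Group G] (𝒢 : GarsideGroup G)

/-- Left divisibility of a Garside group. -/
def le (a b : G) : Prop := LeftDvd 𝒢.pos a b

variable {𝒢}

theorem le_def {a b : G} : 𝒢.le a b ↔ a⁻¹ * b ∈ 𝒢.pos := Iff.rfl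

theorem le_refl' (a : G) : 𝒢.le a a := by
  rw [le_def]; simp [𝒢.pos.one_mem]

theorem le_trans' {a b c : G} (h : 𝒢.le a b) (h' : 𝒢.le b c) : 𝒢.le a c := by
  rw [le_def] at *
  have := 𝒢.pos.mul_mem h h'
  simpa [mul_assoc] using this

theorem le_antisymm' {a b : G} (h : 𝒢.le a b) (h' : 𝒢.le b a) : a = b := by
  rw [le_def] at *
  have := 𝒢.pos_antisymm _ h (by simpa using h')
  exact (inv_mul_eq_one.mp this)

theorem mul_le_mul_left_iff' {a b : G} (c : G) : 𝒢.le (c * a) (c * b) ↔ 𝒢.le a b := by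
  simp only [le_def]; simp [mul_assoc]

theorem le_mul_pos {a b : G} (hb : b ∈ 𝒢.pos) : 𝒢.le a (a * b) := by
  rw [le_def]; simpa using hb

theorem one_le_iff {a : G} : 𝒢.le 1 a ↔ a ∈ 𝒢.pos := by
  rw [le_def]; simp

theorem gcd_eq {a b c : G} (h1 : 𝒢.le c a) (h2 : 𝒢.le c b)
    (h3 : ∀ d, 𝒢.le d a → 𝒢.le d b → 𝒢.le d c) : 𝒢.gcdL a b = c :=
  le_antisymm' (h3 _ (𝒢.gcdL_dvd_left a b) (𝒢.gcdL_dvd_right a b)) (𝒢.dvd_gcdL a b c h1 h2)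

theorem gcd_le_left (a b : G) : 𝒢.le (𝒢.gcdL a b) a := 𝒢.gcdL_dvd_left a b

theorem gcd_le_right (a b : G) : 𝒢.le (𝒢.gcdL a b) b := 𝒢.gcdL_dvd_right a b

theorem le_gcd {a b c : G} (h1 : 𝒢.le c a) (h2 : 𝒢.le c b) : 𝒢.le c (𝒢.gcdL a b) :=
  𝒢.dvd_gcdL a b c h1 h2

theorem mul_gcd (c a b : G) : 𝒢.gcdL (c * a) (c * b) = c * 𝒢.gcdL a b := by
  apply gcd_eq
  · exact (mul_le_mul_left_iff' c).2 (gcd_le_left a b)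
  · exact (mul_le_mul_left_iff' c).2 (gcd_le_right a b)
  · intro d h1 h2
    have e : d = c * (c⁻¹ * d) := by group
    rw [e, mul_le_mul_left_iff'] at h1 h2
    rw [e, mul_le_mul_left_iff']
    exact le_gcd h1 h2

/-- conjugating a simple element by `Δ` (one way) gives a positive element. -/
theorem simple_conj {s : G} (hs : Simple 𝒢.pos 𝒢.Δ s) :
    Simple 𝒢.pos 𝒢.Δ (𝒢.Δ⁻¹ * s * 𝒢.Δ) := by
  obtain ⟨hs1, hs2⟩ := hs
  have h1 : Simple 𝒢.pos 𝒢.Δ (s⁻¹ * 𝒢.Δ) :=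
    (𝒢.divisors_Δ _).2 ⟨hs2, by unfold RightDvd; simpa using hs1⟩
  have h2 : (s⁻¹ * 𝒢.Δ)⁻¹ * 𝒢.Δ ∈ 𝒢.pos := h1.2
  refine (𝒢.divisors_Δ _).2 ⟨by simpa [mul_assoc] using h2, ?_⟩
  unfold RightDvd
  have := h1.1
  simpa [mul_assoc] using this

theorem simple_conj' {s : G} (hs : Simple 𝒢.pos 𝒢.Δ s) :
    Simple 𝒢.pos 𝒢.Δ (𝒢.Δ * s * 𝒢.Δ⁻¹) := by
  obtain ⟨hs1, hs2⟩ := (𝒢.divisors_Δ _).1 hs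
  have hs2' : 𝒢.Δ * s⁻¹ ∈ 𝒢.pos := hs2
  have h1 := (𝒢.divisors_Δ _).1 ⟨hs2', by unfold LeftDvd; simpa [mul_assoc] using hs1⟩
  have h2 : 𝒢.Δ * (𝒢.Δ * s⁻¹)⁻¹ ∈ 𝒢.pos := h1.2
  refine ⟨by simpa [mul_assoc] using h2, ?_⟩
  unfold LeftDvd
  have := h1.1
  simpa [mul_assoc] using this

theorem list_prod_pos {l : List G} (h : ∀ s ∈ l, Simple 𝒢.pos 𝒢.Δ s) : l.prod ∈ 𝒢.pos :=
  𝒢.pos.list_prod_mem fun s hs => (h s hs).1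

/-- The head of a weighted list is the gcd of its product with `Δ`. -/
theorem head_gcd (l : List G) : ∀ s : G, (∀ t ∈ s :: l, Simple 𝒢.pos 𝒢.Δ t) →
    List.IsChain (fun s t => 𝒢.gcdL (s * t) 𝒢.Δ = s) (s :: l) →
    𝒢.gcdL (s * l.prod) 𝒢.Δ = s := by
  induction l with
  | nil =>
    intro s hs _
    have h := hs s (by simp)
    simp only [List.prod_nil, mul_one]
    exact gcd_eq (le_refl' s) h.2 fun d h1 _ => h1
  | cons t l ih =>
    intro s hs hc
    have h := hs s (by simp)
    have ih' := ih t (fun u hu => hs u (by simp at hu ⊢; tauto)) (List.IsChain.tail hc)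
    have hst : 𝒢.gcdL (s * t) 𝒢.Δ = s := by
      rw [List.isChain_cons_cons] at hc; exact hc.1
    rw [List.prod_cons]
    apply gcd_eq
    · exact le_mul_pos (list_prod_pos (l := t :: l) fun u hu => hs u (by simp at hu ⊢; tauto))
    · exact h.2
    · intro d h1 h2
      have h3 : 𝒢.le d (s * 𝒢.Δ) := by
        refine le_trans' h2 ?_
        have := (simple_conj h).1
        rw [le_def]; simpa [mul_assoc] using this
      have h4 := le_gcd h1 h3
      rw [mul_gcd, ih'] at h4
      rw [← hst]
      exact le_gcd h4 h2

theorem one_nf : IsLeftNF 𝒢.pos 𝒢.Δ 𝒢.gcdL 0 [] 1 := by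
  refine ⟨by simp, by simp, List.IsChain.nil⟩

theorem zpow_nf (k : ℤ) : IsLeftNF 𝒢.pos 𝒢.Δ 𝒢.gcdL k [] (𝒢.Δ ^ k) := by
  refine ⟨by simp, by simp, List.IsChain.nil⟩

theorem Δ_npow_pos (n : ℕ) : 𝒢.Δ ^ n ∈ 𝒢.pos := 𝒢.pos.pow_mem 𝒢.Δ_pos n

theorem Δ_zpow_pos {k : ℤ} (h : 0 ≤ k) : 𝒢.Δ ^ k ∈ 𝒢.pos := by
  lift k to ℕ using h
  simpa using Δ_npow_pos k

theorem nf_nonneg {x : G} (hx : x ∈ 𝒢.pos) {k : ℤ} {l : List G}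
    (h : IsLeftNF 𝒢.pos 𝒢.Δ 𝒢.gcdL k l x) : 0 ≤ k := by
  by_contra hk
  push Not at hk
  obtain ⟨h1, h2, h3⟩ := h
  have hle : 𝒢.le 𝒢.Δ l.prod := by
    have : l.prod = 𝒢.Δ * (𝒢.Δ ^ (-k - 1) * x) := by
      rw [h1, ← mul_assoc, ← mul_assoc, ← zpow_one_add, ← zpow_add]
      simp
    rw [this]
    exact le_mul_pos (𝒢.pos.mul_mem (Δ_zpow_pos (by omega)) hx)
  cases l with
  | nil =>
    have hx1 : x = 𝒢.Δ ^ k := by simpa using h1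
    have : x = 1 := 𝒢.pos_antisymm x hx (by
      rw [hx1, ← zpow_neg]; exact Δ_zpow_pos (by omega))
    have := (𝒢.lnf_unique 1 k 0 [] [] (by rw [← this, hx1]; exact zpow_nf k) one_nf).1
    omega
  | cons s l =>
    have hs := h2 s (by simp)
    have hg := head_gcd l s (fun t ht => (h2 t ht).1) h3
    rw [List.prod_cons] at hle
    have h4 := le_gcd hle (le_refl' _)
    rw [hg] at h4
    exact hs.2.2 (le_antisymm' hs.1.2 h4)

theorem pos_conj {x : G} (hx : x ∈ 𝒢.pos) : 𝒢.Δ⁻¹ * x * 𝒢.Δ ∈ 𝒢.pos := by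
  obtain ⟨⟨k, l⟩, h⟩ := 𝒢.lnf_exists x
  have hk := nf_nonneg hx h
  obtain ⟨h1, h2, h3⟩ := h
  simp only at h1 h2 hk
  have key : ∀ l : List G, (∀ s ∈ l, Simple 𝒢.pos 𝒢.Δ s) → 𝒢.Δ⁻¹ * l.prod * 𝒢.Δ ∈ 𝒢.pos := by
    intro l
    induction l with
    | nil => intro _; simp [𝒢.pos.one_mem]
    | cons s l ih =>
      intro h
      have a := (simple_conj (h s (by simp))).1
      have b := ih fun t ht => h t (by simp [ht])
      have := 𝒢.pos.mul_mem a b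
      simpa [mul_assoc] using this
  have e : 𝒢.Δ⁻¹ * x * 𝒢.Δ = 𝒢.Δ ^ k * (𝒢.Δ⁻¹ * l.prod * 𝒢.Δ) := by rw [h1]; group
  rw [e]
  exact 𝒢.pos.mul_mem (Δ_zpow_pos hk) (key l fun s hs => (h2 s hs).1)

theorem pos_conj' {x : G} (hx : x ∈ 𝒢.pos) : 𝒢.Δ * x * 𝒢.Δ⁻¹ ∈ 𝒢.pos := by
  obtain ⟨⟨k, l⟩, h⟩ := 𝒢.lnf_exists x
  have hk := nf_nonneg hx h
  obtain ⟨h1, h2, h3⟩ := h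
  simp only at h1 h2 hk
  have key : ∀ l : List G, (∀ s ∈ l, Simple 𝒢.pos 𝒢.Δ s) → 𝒢.Δ * l.prod * 𝒢.Δ⁻¹ ∈ 𝒢.pos := by
    intro l
    induction l with
    | nil => intro _; simp [𝒢.pos.one_mem]
    | cons s l ih =>
      intro h
      have a := (simple_conj' (h s (by simp))).1
      have b := ih fun t ht => h t (by simp [ht])
      have := 𝒢.pos.mul_mem a b
      simpa [mul_assoc] using this
  have e : 𝒢.Δ * x * 𝒢.Δ⁻¹ = 𝒢.Δ ^ k * (𝒢.Δ * l.prod * 𝒢.Δ⁻¹) := by rw [h1]; group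
  rw [e]
  exact 𝒢.pos.mul_mem (Δ_zpow_pos hk) (key l fun s hs => (h2 s hs).1)

theorem pos_conj_zpow {x : G} (k : ℤ) (hx : x ∈ 𝒢.pos) :
    𝒢.Δ ^ (-k) * x * 𝒢.Δ ^ k ∈ 𝒢.pos := by
  induction k using Int.induction_on with
  | zero => simpa using hx
  | succ i ih =>
    have := pos_conj ih
    convert this using 1
    group
  | pred i ih =>
    have := pos_conj' ih
    convert this using 1
    group

/-- right multiplication by powers of `Δ` preserves left divisibility. -/
theorem mul_zpow_le_iff {a b : G} (k : ℤ) : 𝒢.le (a * 𝒢.Δ ^ k) (b * 𝒢.Δ ^ k) ↔ 𝒢.le a b := by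
  simp only [le_def]
  constructor
  · intro h
    have := pos_conj_zpow (-k) h
    convert this using 1
    group
  · intro h
    have := pos_conj_zpow k h
    convert this using 1
    group

theorem gcd_mul_zpow (a b : G) (k : ℤ) :
    𝒢.gcdL (a * 𝒢.Δ ^ k) (b * 𝒢.Δ ^ k) = 𝒢.gcdL a b * 𝒢.Δ ^ k := by
  apply gcd_eq
  · exact (mul_zpow_le_iff k).2 (gcd_le_left a b)
  · exact (mul_zpow_le_iff k).2 (gcd_le_right a b)
  · intro d h1 h2
    have e : d = d * 𝒢.Δ ^ (-k) * 𝒢.Δ ^ k := by group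
    rw [e, mul_zpow_le_iff] at h1 h2
    rw [e, mul_zpow_le_iff]
    exact le_gcd h1 h2

theorem mul_zpow_le_zpow {a : G} {k j : ℤ} (h : 𝒢.le a (𝒢.Δ ^ k)) :
    𝒢.le (a * 𝒢.Δ ^ j) (𝒢.Δ ^ (k + j)) := by
  rw [zpow_add]; exact (mul_zpow_le_iff j).2 h

theorem le_mul_zpow (a : G) {k : ℤ} (h : 0 ≤ k) : 𝒢.le a (a * 𝒢.Δ ^ k) :=
  le_mul_pos (Δ_zpow_pos h)

/-- `f ≼ Δ^{k+1}` implies `f ≼ (f ∧ Δ) Δ^k`. -/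
theorem le_gcd_mul {f : G} (n : ℕ) (h : 𝒢.le f (𝒢.Δ ^ ((n : ℤ) + 1))) :
    𝒢.le f (𝒢.gcdL f 𝒢.Δ * 𝒢.Δ ^ (n : ℤ)) := by
  rw [← gcd_mul_zpow]
  apply le_gcd (le_mul_zpow f (by omega))
  rw [← zpow_one_add, add_comm]; exact h

theorem list_prod_le : ∀ (l : List G), (∀ s ∈ l, Simple 𝒢.pos 𝒢.Δ s) →
    𝒢.le l.prod (𝒢.Δ ^ (l.length : ℤ)) := by
  intro l
  induction l with
  | nil => intro _; simpa using le_refl' 1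
  | cons s l ih =>
    intro h
    have ih' := ih fun t ht => h t (by simp [ht])
    have hs : 𝒢.le s (𝒢.Δ ^ (1 : ℤ)) := by rw [zpow_one]; exact (h s (by simp)).2
    have h2 := mul_zpow_le_zpow (j := (l.length : ℤ)) hs
    rw [List.prod_cons]
    refine le_trans' ((mul_le_mul_left_iff' s).2 ih') ?_
    convert h2 using 2
    push_cast [List.length_cons]; ring

/-- prefixes of weighted lists are gcd's with powers of `Δ`. -/
theorem take_gcd (l : List G) : ∀ k : ℕ, (∀ t ∈ l, Simple 𝒢.pos 𝒢.Δ t) →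
    List.IsChain (fun s t => 𝒢.gcdL (s * t) 𝒢.Δ = s) l →
    ∀ f, 𝒢.le f l.prod → 𝒢.le f (𝒢.Δ ^ (k : ℤ)) → 𝒢.le f (l.take k).prod := by
  induction l with
  | nil => intro k _ _ f h _; simpa using h
  | cons s l ih =>
    intro k hs hc f h1 h2
    cases k with
    | zero => simpa using h2
    | succ k =>
      have hg := head_gcd l s hs hc
      rw [List.prod_cons] at h1
      have h3 : 𝒢.le (𝒢.gcdL f 𝒢.Δ) s := by
        rw [← hg]
        exact le_gcd (le_trans' (gcd_le_left _ _) h1) (gcd_le_right _ _)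
      have h4 : 𝒢.le f (s * 𝒢.Δ ^ (k : ℤ)) :=
        le_trans' (le_gcd_mul k (by simpa using h2)) ((mul_zpow_le_iff _).2 h3)
      have e : f = s * (s⁻¹ * f) := by group
      rw [e, mul_le_mul_left_iff'] at h1 h4
      have := ih k (fun t ht => hs t (by simp [ht])) (List.IsChain.tail hc) _ h1 h4
      rw [e]
      simpa using (mul_le_mul_left_iff' s).2 this

theorem lnf_spec (x : G) : IsLeftNF 𝒢.pos 𝒢.Δ 𝒢.gcdL (𝒢.lnf x).1 (𝒢.lnf x).2 x :=
  Classical.choose_spec (𝒢.lnf_exists x)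

theorem le_infG_iff {x : G} {k : ℤ} : k ≤ 𝒢.inf x ↔ 𝒢.le (𝒢.Δ ^ k) x := by
  obtain ⟨h1, h2, h3⟩ := lnf_spec (𝒢 := 𝒢) x
  have e : (𝒢.Δ ^ k)⁻¹ * x = 𝒢.Δ ^ (𝒢.inf x - k) * (𝒢.lnf x).2.prod := by
    conv_lhs => rw [h1]
    unfold inf
    group
  rw [le_def, e]
  constructor
  · intro h
    exact 𝒢.pos.mul_mem (Δ_zpow_pos (by omega)) (list_prod_pos fun s hs => (h2 s hs).1)
  · intro h
    have := nf_nonneg h ⟨rfl, h2, h3⟩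
    omega

theorem supG_le_iff {x : G} {k : ℤ} : 𝒢.sup x ≤ k ↔ 𝒢.le x (𝒢.Δ ^ k) := by
  obtain ⟨h1, h2, h3⟩ := lnf_spec (𝒢 := 𝒢) x
  have hl : ∀ s ∈ (𝒢.lnf x).2, Simple 𝒢.pos 𝒢.Δ s := fun s hs => (h2 s hs).1
  unfold sup len inf
  set p := (𝒢.lnf x).1
  set l := (𝒢.lnf x).2
  have e : 𝒢.Δ ^ k = 𝒢.Δ ^ p * 𝒢.Δ ^ (k - p) := by rw [← zpow_add]; congr 1; ring
  rw [h1, e, mul_le_mul_left_iff']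
  constructor
  · intro h
    refine le_trans' (list_prod_le l hl) ?_
    have e : 𝒢.Δ ^ (k - p) = 𝒢.Δ ^ (l.length : ℤ) * 𝒢.Δ ^ (k - p - l.length) := by
      rw [← zpow_add]; congr 1; ring
    rw [e]
    exact le_mul_zpow _ (by omega)
  · intro h
    have hpos : 𝒢.Δ ^ (k - p) ∈ 𝒢.pos :=
      one_le_iff.1 (le_trans' (one_le_iff.2 (list_prod_pos hl)) h)
    have hj : 0 ≤ k - p := nf_nonneg hpos (zpow_nf _)
    obtain ⟨j, hj'⟩ := Int.eq_ofNat_of_zero_le hj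
    rw [hj'] at h
    by_contra hcon
    have hlt : j < l.length := by omega
    have h5 := take_gcd l j hl h3 l.prod (le_refl' _) h
    rw [← List.prod_take_mul_prod_drop l j] at h5
    have h6 : (l.drop j).prod = 1 := by
      apply le_antisymm' (𝒢 := 𝒢)
      · rw [← mul_le_mul_left_iff' (𝒢 := 𝒢) (l.take j).prod, mul_one]
        exact h5
      · exact one_le_iff.2 (list_prod_pos fun s hs => hl s (List.mem_of_mem_drop hs))
    rw [List.drop_eq_getElem_cons hlt, List.prod_cons] at h6
    have h7 := h2 l[j] (List.getElem_mem hlt)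
    apply h7.2.1
    apply le_antisymm' (𝒢 := 𝒢)
    · rw [← h6]
      exact le_mul_pos (list_prod_pos fun s hs => hl s (List.mem_of_mem_drop hs))
    · exact one_le_iff.2 h7.1.1

theorem gcd_conj_zpow (a : G) (k : ℤ) :
    𝒢.gcdL (𝒢.Δ ^ k * a * 𝒢.Δ ^ (-k)) 𝒢.Δ = 𝒢.Δ ^ k * 𝒢.gcdL a 𝒢.Δ * 𝒢.Δ ^ (-k) := by
  have e : 𝒢.Δ = 𝒢.Δ ^ k * 𝒢.Δ * 𝒢.Δ ^ (-k) := by group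
  rw [← mul_gcd, ← gcd_mul_zpow, ← e]

theorem iotaL_eq (x : G) : 𝒢.iotaL x = 𝒢.gcdL (x * 𝒢.Δ ^ (-𝒢.inf x)) 𝒢.Δ := by
  obtain ⟨h1, h2, h3⟩ := lnf_spec (𝒢 := 𝒢) x
  unfold iotaL inf tau
  set p := (𝒢.lnf x).1
  set l := (𝒢.lnf x).2
  have h4 : 𝒢.gcdL l.prod 𝒢.Δ = l.headD 1 := by
    cases hh : l with
    | nil =>
      simp only [List.prod_nil, List.headD_nil]
      exact gcd_eq (le_refl' _) (one_le_iff.2 𝒢.Δ_pos) fun d h _ => h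
    | cons s l' =>
      simp only [List.prod_cons, List.headD_cons]
      rw [hh] at h2 h3
      exact head_gcd l' s (fun t ht => (h2 t ht).1) h3
  rw [neg_neg, ← h4, ← gcd_conj_zpow, ← h1]

end helpers

section phi

variable {G : Type*} [Group G] (𝒢 : GarsideGroup G)

/-- `Φ(u) = (x u Δ^{-p}) ∧ u Δ`, i.e. `u` times the initial factor of `u⁻¹ x u`. -/
def Phi (p : ℤ) (x u : G) : G := 𝒢.gcdL (x * u * 𝒢.Δ ^ (-p)) (u * 𝒢.Δ)

/-- `u⁻¹ x u` lies between `Δ^p` and `Δ^q`. -/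
def Kset (p q : ℤ) (x u : G) : Prop :=
  𝒢.le (u * 𝒢.Δ ^ p) (x * u) ∧ 𝒢.le (x * u) (u * 𝒢.Δ ^ q)

variable {𝒢}

theorem Phi_mono {p : ℤ} {x u v : G} (h : 𝒢.le u v) : 𝒢.le (𝒢.Phi p x u) (𝒢.Phi p x v) := by
  unfold Phi
  apply le_gcd
  · refine le_trans' (gcd_le_left _ _) ?_
    rw [mul_zpow_le_iff, mul_le_mul_left_iff']; exact h
  · refine le_trans' (gcd_le_right _ _) ?_
    have := (mul_zpow_le_iff (𝒢 := 𝒢) (a := u) (b := v) 1).2 h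
    simpa using this

theorem Phi_gcd {p : ℤ} {x u v : G} :
    𝒢.Phi p x (𝒢.gcdL u v) = 𝒢.gcdL (𝒢.Phi p x u) (𝒢.Phi p x v) := by
  apply le_antisymm' (𝒢 := 𝒢)
  · exact le_gcd (Phi_mono (gcd_le_left _ _)) (Phi_mono (gcd_le_right _ _))
  · have hu := gcd_le_left (𝒢 := 𝒢) (𝒢.Phi p x u) (𝒢.Phi p x v)
    have hv := gcd_le_right (𝒢 := 𝒢) (𝒢.Phi p x u) (𝒢.Phi p x v)
    set g := 𝒢.gcdL (𝒢.Phi p x u) (𝒢.Phi p x v)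
    unfold Phi at hu hv ⊢
    apply le_gcd
    · rw [← mul_gcd, ← gcd_mul_zpow]
      exact le_gcd (le_trans' hu (gcd_le_left _ _)) (le_trans' hv (gcd_le_left _ _))
    · have := gcd_mul_zpow (𝒢 := 𝒢) u v 1
      rw [zpow_one] at this
      rw [← this]
      exact le_gcd (le_trans' hu (gcd_le_right _ _)) (le_trans' hv (gcd_le_right _ _))

theorem Phi_mul_zpow {p : ℤ} {x u : G} (k : ℤ) :
    𝒢.Phi p x (u * 𝒢.Δ ^ k) = 𝒢.Phi p x u * 𝒢.Δ ^ k := by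
  unfold Phi
  rw [← gcd_mul_zpow]
  congr 1 <;> group

theorem Phi_self_mul {p : ℤ} {x u : G} : 𝒢.Phi p x (x * u) = x * 𝒢.Phi p x u := by
  unfold Phi
  rw [← mul_gcd]
  congr 1 <;> group

theorem Phi_conj {p : ℤ} {x w u : G} :
    𝒢.Phi p x (w * u) = w * 𝒢.Phi p (w⁻¹ * x * w) u := by
  unfold Phi
  rw [← mul_gcd]
  congr 1 <;> group

theorem PhiIter_mono {p : ℤ} {x u v : G} (n : ℕ) (h : 𝒢.le u v) :
    𝒢.le ((𝒢.Phi p x)^[n] u) ((𝒢.Phi p x)^[n] v) := by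
  induction n with
  | zero => exact h
  | succ n ih => simp only [Function.iterate_succ_apply']; exact Phi_mono ih

theorem PhiIter_gcd {p : ℤ} {x u v : G} (n : ℕ) :
    (𝒢.Phi p x)^[n] (𝒢.gcdL u v) = 𝒢.gcdL ((𝒢.Phi p x)^[n] u) ((𝒢.Phi p x)^[n] v) := by
  induction n with
  | zero => rfl
  | succ n ih => simp only [Function.iterate_succ_apply', ih, Phi_gcd]

theorem PhiIter_mul_zpow {p : ℤ} {x u : G} (k : ℤ) (n : ℕ) :
    (𝒢.Phi p x)^[n] (u * 𝒢.Δ ^ k) = (𝒢.Phi p x)^[n] u * 𝒢.Δ ^ k := by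
  induction n with
  | zero => rfl
  | succ n ih => simp only [Function.iterate_succ_apply', ih, Phi_mul_zpow]

theorem PhiIter_pow_mul {p : ℤ} {x u : G} (k n : ℕ) :
    (𝒢.Phi p x)^[n] (x ^ k * u) = x ^ k * (𝒢.Phi p x)^[n] u := by
  have h1 : ∀ u, 𝒢.Phi p x (x ^ k * u) = x ^ k * 𝒢.Phi p x u := by
    intro u
    induction k with
    | zero => simp
    | succ k ih => rw [pow_succ', mul_assoc, Phi_self_mul, ih, mul_assoc]
  induction n with
  | zero => rfl
  | succ n ih => simp only [Function.iterate_succ_apply', ih, h1]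

theorem PhiIter_conj {p : ℤ} {x w u : G} (n : ℕ) :
    (𝒢.Phi p x)^[n] (w * u) = w * (𝒢.Phi p (w⁻¹ * x * w))^[n] u := by
  induction n with
  | zero => rfl
  | succ n ih => simp only [Function.iterate_succ_apply', ih, Phi_conj]

theorem K_gcd {p q : ℤ} {x u v : G} (hu : 𝒢.Kset p q x u) (hv : 𝒢.Kset p q x v) :
    𝒢.Kset p q x (𝒢.gcdL u v) := by
  constructor
  · rw [← gcd_mul_zpow, ← mul_gcd]
    exact le_gcd (le_trans' (gcd_le_left _ _) hu.1) (le_trans' (gcd_le_right _ _) hv.1)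
  · rw [← gcd_mul_zpow, ← mul_gcd]
    exact le_gcd (le_trans' (gcd_le_left _ _) hu.2) (le_trans' (gcd_le_right _ _) hv.2)

theorem K_mul_zpow {p q : ℤ} {x u : G} (k : ℤ) (hu : 𝒢.Kset p q x u) :
    𝒢.Kset p q x (u * 𝒢.Δ ^ k) := by
  have e : ∀ j : ℤ, u * 𝒢.Δ ^ k * 𝒢.Δ ^ j = u * 𝒢.Δ ^ j * 𝒢.Δ ^ k := by intro j; group
  constructor
  · rw [e, ← mul_assoc, mul_zpow_le_iff]; exact hu.1
  · rw [e, ← mul_assoc, mul_zpow_le_iff]; exact hu.2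

theorem K_self_mul {p q : ℤ} {x u : G} (hu : 𝒢.Kset p q x u) : 𝒢.Kset p q x (x * u) := by
  constructor
  · rw [mul_assoc, mul_le_mul_left_iff']; exact hu.1
  · rw [mul_assoc, mul_le_mul_left_iff']; exact hu.2

theorem K_pow_mul {p q : ℤ} {x u : G} (n : ℕ) (hu : 𝒢.Kset p q x u) :
    𝒢.Kset p q x (x ^ n * u) := by
  induction n with
  | zero => simpa using hu
  | succ n ih => rw [pow_succ', mul_assoc]; exact K_self_mul ih

theorem K_Phi {p q : ℤ} {x u : G} (hu : 𝒢.Kset p q x u) : 𝒢.Kset p q x (𝒢.Phi p x u) := by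
  unfold Phi
  apply K_gcd
  · exact K_mul_zpow _ (K_self_mul hu)
  · have := K_mul_zpow 1 hu
    simpa using this

theorem K_PhiIter {p q : ℤ} {x u : G} (n : ℕ) (hu : 𝒢.Kset p q x u) :
    𝒢.Kset p q x ((𝒢.Phi p x)^[n] u) := by
  induction n with
  | zero => exact hu
  | succ n ih => rw [Function.iterate_succ_apply']; exact K_Phi ih

theorem K_conj {p q : ℤ} {x u : G} (hu : 𝒢.Kset p q x u) :
    𝒢.le (𝒢.Δ ^ p) (u⁻¹ * x * u) ∧ 𝒢.le (u⁻¹ * x * u) (𝒢.Δ ^ q) := by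
  have e : x * u = u * (u⁻¹ * x * u) := by group
  unfold Kset at hu
  rw [e, mul_le_mul_left_iff', mul_le_mul_left_iff'] at hu
  exact hu

theorem K_one {x : G} : 𝒢.Kset (𝒢.inf x) (𝒢.sup x) x 1 := by
  constructor
  · simpa using le_infG_iff.1 (le_refl (𝒢.inf x))
  · simpa using supG_le_iff.1 (le_refl (𝒢.sup x))

theorem le_Phi {p q : ℤ} {x u : G} (hu : 𝒢.Kset p q x u) : 𝒢.le u (𝒢.Phi p x u) := by
  unfold Phi
  apply le_gcd
  · have := (mul_zpow_le_iff (-p)).2 hu.1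
    simpa [mul_assoc] using this
  · exact le_mul_pos 𝒢.Δ_pos

theorem K_inf_len {x : G} (hx : x ∈ 𝒢.SSS x) {u : G}
    (hu : 𝒢.Kset (𝒢.inf x) (𝒢.sup x) x u) :
    𝒢.inf (u⁻¹ * x * u) = 𝒢.inf x ∧ 𝒢.len (u⁻¹ * x * u) = 𝒢.len x := by
  obtain ⟨h1, h2⟩ := K_conj hu
  rw [← le_infG_iff] at h1
  rw [← supG_le_iff] at h2
  have h3 := hx.2 (u⁻¹ * x * u) (isConj_iff.2 ⟨u⁻¹, by simp⟩)
  unfold sup at h2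
  omega

theorem cycling_iter {x : G} (hx : x ∈ 𝒢.SSS x) (n : ℕ) :
    ((List.range n).map fun i => 𝒢.iotaL ((𝒢.cL)^[i] x)).prod = (𝒢.Phi (𝒢.inf x) x)^[n] 1 ∧
    (𝒢.cL)^[n] x = ((𝒢.Phi (𝒢.inf x) x)^[n] 1)⁻¹ * x * (𝒢.Phi (𝒢.inf x) x)^[n] 1 := by
  induction n with
  | zero => simp
  | succ n ih =>
    obtain ⟨h1, h2⟩ := ih
    have hK := K_PhiIter n (K_one (𝒢 := 𝒢) (x := x))
    set u := (𝒢.Phi (𝒢.inf x) x)^[n] 1 with hu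
    have hinf := (K_inf_len hx hK).1
    have key : u * 𝒢.iotaL ((𝒢.cL)^[n] x) = 𝒢.Phi (𝒢.inf x) x u := by
      rw [iotaL_eq, h2, hinf, Phi, ← mul_gcd]
      congr 1; group
    rw [List.range_succ, List.map_append, List.prod_append, h1, Function.iterate_succ_apply',
      Function.iterate_succ_apply', ← hu, ← key]
    refine ⟨by simp, ?_⟩
    rw [cL]
    generalize 𝒢.iotaL ((𝒢.cL)^[n] x) = c
    rw [h2]; group

end phi

section rigid

variable {G : Type*} [Group G] {𝒢 : GarsideGroup G}

/-- partial products of a sequence -/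
def TT (S : ℕ → G) (n : ℕ) : G := ((List.range n).map S).prod

theorem TT_succ (S : ℕ → G) (n : ℕ) : TT S (n + 1) = TT S n * S n := by
  unfold TT; rw [List.range_succ]; simp

theorem TT_zero (S : ℕ → G) : TT S 0 = 1 := by simp [TT]

theorem TT_le {S : ℕ → G} (hS : ∀ n, Simple 𝒢.pos 𝒢.Δ (S n)) (n : ℕ) :
    𝒢.le (TT S n) (𝒢.Δ ^ (n : ℤ)) := by
  have := list_prod_le (𝒢 := 𝒢) ((List.range n).map S) (by
    intro s hs; obtain ⟨i, _, rfl⟩ := List.mem_map.1 hs; exact hS i)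
  simpa [TT] using this

theorem TT_mono {S : ℕ → G} (hS : ∀ n, Simple 𝒢.pos 𝒢.Δ (S n)) {m n : ℕ} (h : m ≤ n) :
    𝒢.le (TT S m) (TT S n) := by
  induction n, h using Nat.le_induction with
  | base => exact le_refl' _
  | succ n _ ih => rw [TT_succ]; exact le_trans' ih (le_mul_pos (hS n).1)

theorem TT_gcd {S : ℕ → G} (hS : ∀ n, Simple 𝒢.pos 𝒢.Δ (S n))
    (hw : ∀ n, 𝒢.gcdL (S n * S (n + 1)) 𝒢.Δ = S n) {k n : ℕ} (h : k ≤ n) {f : G}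
    (h1 : 𝒢.le f (TT S n)) (h2 : 𝒢.le f (𝒢.Δ ^ (k : ℤ))) : 𝒢.le f (TT S k) := by
  have := take_gcd (𝒢 := 𝒢) ((List.range n).map S) k (by
    intro s hs; obtain ⟨i, _, rfl⟩ := List.mem_map.1 hs; exact hS i) (by
    rw [List.isChain_iff_getElem]; intro i hi; simpa using hw i) f h1 h2
  rw [← List.map_take, List.take_range, min_eq_left h] at this
  exact this

theorem simple_conj_zpow {s : G} (k : ℤ) (hs : Simple 𝒢.pos 𝒢.Δ s) :
    Simple 𝒢.pos 𝒢.Δ (𝒢.Δ ^ k * s * 𝒢.Δ ^ (-k)) := by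
  constructor
  · have := pos_conj_zpow (-k) hs.1
    simpa using this
  · have h : 𝒢.le s 𝒢.Δ := hs.2
    rw [← mul_zpow_le_iff (-k), ← mul_le_mul_left_iff' (𝒢.Δ ^ k)] at h
    have e : 𝒢.Δ ^ k * (𝒢.Δ * 𝒢.Δ ^ (-k)) = 𝒢.Δ := by group
    rw [e, ← mul_assoc] at h
    exact h

/-- The infinite weighted sequence attached to a rigid element. -/
theorem rigid_seq {y : G} (hy : 𝒢.LeftRigid y) :
    1 ≤ 𝒢.len y ∧ ∃ S : ℕ → G, (∀ n, Simple 𝒢.pos 𝒢.Δ (S n)) ∧ (∀ n, S n ≠ 1) ∧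
      (∀ n, S n ≠ 𝒢.Δ) ∧ (∀ n, 𝒢.gcdL (S n * S (n + 1)) 𝒢.Δ = S n) ∧
      ∀ k, y * TT S k * 𝒢.Δ ^ (-𝒢.inf y) = TT S (k + 𝒢.len y) := by
  obtain ⟨h0, -, h2, h3⟩ := hy
  obtain ⟨h1, -, -⟩ := lnf_spec (𝒢 := 𝒢) y
  have hi : 𝒢.iotaL y = 𝒢.Δ ^ (𝒢.lnf y).1 * (𝒢.lnf y).2.headD 1 * 𝒢.Δ ^ (-(𝒢.lnf y).1) := by
    unfold iotaL tau; simp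
  rw [hi] at h2 h3
  clear hi
  unfold len inf
  generalize (𝒢.lnf y).1 = p at *
  generalize (𝒢.lnf y).2 = l at *
  have hr : 0 < l.length := List.length_pos_iff.2 h0
  refine ⟨hr, ?_⟩
  have hmem : ∀ n, l.getD (n % l.length) 1 ∈ l := by
    intro n
    have := Nat.mod_lt n hr
    rw [List.getD_eq_getElem _ _ this]; exact List.getElem_mem this
  let S : ℕ → G := fun n => 𝒢.Δ ^ (p * ((n / l.length : ℕ) + 1 : ℤ)) * l.getD (n % l.length) 1 *
    𝒢.Δ ^ (-(p * ((n / l.length : ℕ) + 1 : ℤ)))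
  have hSdef : ∀ n, S n = 𝒢.Δ ^ (p * ((n / l.length : ℕ) + 1 : ℤ)) * l.getD (n % l.length) 1 *
    𝒢.Δ ^ (-(p * ((n / l.length : ℕ) + 1 : ℤ))) := fun n => rfl
  have hper : ∀ n, S (l.length + n) = 𝒢.Δ ^ p * S n * 𝒢.Δ ^ (-p) := by
    intro n
    rw [hSdef, hSdef, Nat.add_div_left _ hr, Nat.add_mod_left]
    generalize n / l.length = q
    have e1 : p * (((q.succ : ℕ) : ℤ) + 1) = p + p * ((q : ℤ) + 1) := by push_cast; ring
    rw [e1, neg_add, zpow_add, add_comm (-p), zpow_add]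
    simp only [mul_assoc]
  have hTr : TT S l.length = y * 𝒢.Δ ^ (-p) := by
    have e1 : (List.range l.length).map S =
        l.map (MulAut.conj (𝒢.Δ ^ p)) := by
      apply List.ext_getElem (by simp)
      intro i hi1 hi2
      have hil : i < l.length := by simpa using hi1
      simp only [List.getElem_map, List.getElem_range, hSdef, Nat.div_eq_of_lt hil,
        Nat.mod_eq_of_lt hil, List.getD_eq_getElem _ _ hil, MulAut.conj_apply]
      simp
    unfold TT
    rw [e1, ← map_list_prod, h1, MulAut.conj_apply, zpow_neg]
  refine ⟨S, ?_, ?_, ?_, ?_, ?_⟩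
  · intro n
    exact simple_conj_zpow _ (h2 _ (by simp only [List.mem_append]; exact Or.inl (hmem n))).1
  · intro n h
    have hn := (h2 _ (by simp only [List.mem_append]; exact Or.inl (hmem n))).2.1
    apply hn
    rw [hSdef, zpow_neg] at h
    exact conj_eq_one_iff.1 h
  · intro n h
    have hn := (h2 _ (by simp only [List.mem_append]; exact Or.inl (hmem n))).2.2
    apply hn
    rw [hSdef] at h
    generalize l.getD (n % l.length) 1 = s at *
    generalize p * ((n / l.length : ℕ) + 1 : ℤ) = k at *
    have : s = 𝒢.Δ ^ (-k) * (𝒢.Δ ^ k * s * 𝒢.Δ ^ (-k)) * 𝒢.Δ ^ k := by group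
    rw [this, h]; group
  · intro n
    replace h3 := List.isChain_iff_getElem.1 h3
    have hn := Nat.mod_lt n hr
    have h4 := h3 (n % l.length) (by simpa using hn)
    rw [List.getElem_append_left hn] at h4
    have hdm := Nat.div_add_mod n l.length
    have hcm := mul_comm l.length (n / l.length)
    by_cases hc : n % l.length + 1 < l.length
    · rw [List.getElem_append_left hc] at h4
      have hd : (n + 1) / l.length = n / l.length := by
        rw [Nat.div_eq_iff hr]
        constructor <;> omega
      have hm : (n + 1) % l.length = n % l.length + 1 := by
        have := Nat.div_add_mod (n + 1) l.length
        rw [hd] at this; omega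
      rw [hSdef, hSdef, hd, hm, List.getD_eq_getElem _ _ hn, List.getD_eq_getElem _ _ hc]
      conv_rhs => rw [← h4, ← gcd_conj_zpow]
      congr 1; group
    · have hc' : n % l.length + 1 = l.length := by omega
      have hd : (n + 1) / l.length = n / l.length + 1 := by
        rw [Nat.div_eq_iff hr]
        constructor <;> simp only [add_mul, one_mul] <;> omega
      have hm : (n + 1) % l.length = 0 := by
        have h5 := Nat.div_add_mod (n + 1) l.length
        rw [hd, mul_add] at h5; omega
      rw [List.getElem_append_right (by omega)] at h4
      simp only [List.getElem_singleton] at h4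
      rw [hSdef, hSdef, hd, hm, List.getD_eq_getElem _ _ hn]
      have hh : l.headD 1 = l.getD 0 1 := by cases l <;> simp
      rw [hh] at h4
      conv_rhs => rw [← h4, ← gcd_conj_zpow]
      congr 1
      generalize n / l.length = q
      have e1 : p * (((q + 1 : ℕ) : ℤ) + 1) = p * ((q : ℤ) + 1) + p := by push_cast; ring
      rw [e1]
      generalize p * ((q : ℤ) + 1) = j
      group
  · intro k
    induction k with
    | zero => simp [TT_zero, hTr]
    | succ k ih =>
      rw [TT_succ, add_right_comm, TT_succ, ← ih, add_comm k, hper]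
      group

end rigid

end GarsideGroup

end Garside

namespace Garside

open GarsideGroup in

/-- **Lemma 4.9.** Let `G` be a Garside group and `x ∈ SSS(x)` with
`inf(x) = p` and `ℓ(x) > 1`. Suppose `x` is conjugate to a left rigid element
and let `m` be such that `y = c_L^m(x)` is left rigid. With
`C_i = ι_L(c_L^{i-1}(x))`, one has `C₁⋯C_m = (x^m Δ^{-mp}) ∧_L Δ^m`, where
`inf(C₁⋯C_m) = 0` and `sup(C₁⋯C_m) = m`. -/
theorem conjugate_to_rigid_gcd {G : Type*} [Group G] (𝒢 : GarsideGroup G)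
    (x : G) (hx : x ∈ 𝒢.SSS x) (p : ℤ) (hp : 𝒢.inf x = p) (hl : 1 < 𝒢.len x)
    (hconj : ∃ y, IsConj x y ∧ 𝒢.LeftRigid y)
    (m : ℕ) (hm : 𝒢.LeftRigid ((𝒢.cL)^[m] x))
    (C : G) (hC : C = ((List.range m).map fun i => 𝒢.iotaL ((𝒢.cL)^[i] x)).prod) :
    C = 𝒢.gcdL (x ^ m * 𝒢.Δ ^ (-((m : ℤ) * p))) (𝒢.Δ ^ (m : ℤ)) ∧
    𝒢.inf C = 0 ∧ 𝒢.sup C = m := by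

  subst hp
  have hcyc := cycling_iter hx m
  rw [← hC] at hcyc
  obtain ⟨hCP, hy⟩ := hcyc
  have hKC : 𝒢.Kset (𝒢.inf x) (𝒢.sup x) x C := hCP ▸ K_PhiIter m K_one
  obtain ⟨hyinf, hylen⟩ := K_inf_len hx hKC
  rw [← hCP] at hy
  rw [hy] at hm
  obtain ⟨hr, S, hS, hS1, hSΔ, hSw, hSy⟩ := rigid_seq hm
  rw [hyinf, hylen] at hSy
  rw [hylen] at hr
  have hq : 𝒢.sup x = 𝒢.inf x + 𝒢.len x := rfl
  clear hl hconj hm hC hx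
  clear hy
  set p := 𝒢.inf x
  set q := 𝒢.sup x
  set r := 𝒢.len x
  -- `x C T_k Δ^{-p} = C T_{k+r}`
  have hxC : ∀ k, x * (C * TT S k) * 𝒢.Δ ^ (-p) = C * TT S (k + r) := by
    intro k
    rw [← hSy k]; group
  -- one step of the iteration
  have hstep : ∀ k, 𝒢.Phi p x (C * TT S k) = C * TT S (k + 1) := by
    intro k
    unfold Phi
    rw [hxC, mul_assoc, mul_gcd]
    congr 1
    apply gcd_eq
    · exact TT_mono hS (by omega)
    · rw [TT_succ, mul_le_mul_left_iff']; exact (hS k).2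
    · intro d h1 h2
      refine TT_gcd hS hSw (by omega) h1 (le_trans' h2 ?_)
      have := mul_zpow_le_zpow (j := 1) (TT_le hS k)
      simpa using this
  have hiter : ∀ n k, (𝒢.Phi p x)^[n] (C * TT S k) = C * TT S (k + n) := by
    intro n
    induction n with
    | zero => intro k; rfl
    | succ n ih =>
      intro k
      rw [Function.iterate_succ_apply, hstep, ih]; congr 2; ring
  -- injectivity
  have hinj : ∀ n k u, 𝒢.Kset p q x u → 𝒢.le (C * TT S k) u →
      (𝒢.Phi p x)^[n] u = C * TT S (k + n) → u = C * TT S k := by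
    intro n
    induction n with
    | zero => intro k u _ _ h; exact h
    | succ n ih =>
      intro k u hK hle h
      have h1 : 𝒢.Phi p x u = C * TT S (k + 1) := by
        apply ih (k + 1) _ (K_Phi hK)
        · rw [← hstep]; exact Phi_mono hle
        · rw [← Function.iterate_succ_apply, h]; congr 2; ring
      have h2 : 𝒢.le (x * u * 𝒢.Δ ^ (-p)) (𝒢.Phi p x u * 𝒢.Δ ^ ((r : ℤ) - 1)) := by
        unfold Phi
        rw [← gcd_mul_zpow]
        apply le_gcd
        · exact le_mul_zpow _ (by omega)
        · have := (mul_zpow_le_iff (-p)).2 hK.2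
          convert this using 1
          rw [hq]; group
      rw [h1] at h2
      have h3 : 𝒢.le (x * u * 𝒢.Δ ^ (-p)) (C * 𝒢.Δ ^ ((k + r : ℕ) : ℤ)) := by
        refine le_trans' h2 ?_
        rw [mul_assoc, mul_le_mul_left_iff']
        have := mul_zpow_le_zpow (j := (r : ℤ) - 1) (TT_le hS (k + 1))
        convert this using 2
        push_cast; ring
      have h4 : 𝒢.le (x * u * 𝒢.Δ ^ (-p)) (C * TT S (k + 1 + r)) := by
        rw [← hxC, mul_zpow_le_iff, mul_le_mul_left_iff', ← h1]
        exact le_Phi hK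
      have e : x * u * 𝒢.Δ ^ (-p) = C * (C⁻¹ * (x * u * 𝒢.Δ ^ (-p))) := by group
      rw [e, mul_le_mul_left_iff'] at h3 h4
      have h5 := TT_gcd hS hSw (by omega) h4 h3
      rw [← mul_le_mul_left_iff' C, ← e, ← hxC, mul_zpow_le_iff, mul_le_mul_left_iff'] at h5
      exact le_antisymm' h5 hle
  have hKone : 𝒢.Kset p q x 1 := K_one
  have hDm : 𝒢.Kset p q x (𝒢.Δ ^ (m : ℤ)) := by
    simpa using K_mul_zpow (m : ℤ) hKone
  have hAm : 𝒢.Kset p q x (x ^ m * 𝒢.Δ ^ (-((m : ℤ) * p))) := by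
    simpa using K_mul_zpow (-((m : ℤ) * p)) (K_pow_mul m hKone)
  have hCle1 : 𝒢.le C (x ^ m * 𝒢.Δ ^ (-((m : ℤ) * p))) := by
    rw [hCP]
    clear * -
    induction m with
    | zero => simpa using le_refl' 1
    | succ m ih =>
      rw [Function.iterate_succ_apply']
      refine le_trans' (gcd_le_left _ _) ?_
      rw [← mul_le_mul_left_iff' x, ← mul_zpow_le_iff (-p)] at ih
      convert ih using 1
      have e1 : -(((m + 1 : ℕ) : ℤ) * p) = -((m : ℤ) * p) + -p := by push_cast; ring
      rw [e1, zpow_add, pow_succ']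
      simp only [mul_assoc]
  have hCle2 : 𝒢.le C (𝒢.Δ ^ (m : ℤ)) := by
    rw [hCP]
    clear * -
    induction m with
    | zero => simpa using le_refl' 1
    | succ m ih =>
      rw [Function.iterate_succ_apply']
      refine le_trans' (gcd_le_right _ _) ?_
      have := mul_zpow_le_zpow (j := 1) ih
      simpa using this
  have hCpos : 𝒢.le 1 C := by
    rw [hCP]
    have : ∀ n, 𝒢.le 1 ((𝒢.Phi p x)^[n] 1) := by
      intro n
      induction n with
      | zero => exact le_refl' 1
      | succ n ih =>
        rw [Function.iterate_succ_apply']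
        exact le_trans' ih (le_Phi (K_PhiIter n hKone))
    exact this m
  have hyT : ∀ n : ℕ, x ^ n * C * 𝒢.Δ ^ (-((n : ℤ) * p)) = C * TT S (n * r) := by
    intro n
    induction n with
    | zero => simp [TT_zero]
    | succ n ih =>
      have e1 : -(((n + 1 : ℕ) : ℤ) * p) = -((n : ℤ) * p) + -p := by push_cast; ring
      rw [Nat.succ_mul, ← hxC, ← ih, e1, zpow_add, pow_succ']
      simp only [mul_assoc]
  have hTm : 𝒢.gcdL (TT S (m * r)) (𝒢.Δ ^ (m : ℤ)) = TT S m := by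
    have hmr : m ≤ m * r := Nat.le_mul_of_pos_right m hr
    exact gcd_eq (TT_mono hS hmr) (TT_le hS m) fun d h1 h2 => TT_gcd hS hSw hmr h1 h2
  have hD : (𝒢.Phi p x)^[m] (𝒢.gcdL (x ^ m * 𝒢.Δ ^ (-((m : ℤ) * p))) (𝒢.Δ ^ (m : ℤ))) =
      C * TT S (0 + m) := by
    have e1 := PhiIter_mul_zpow (𝒢 := 𝒢) (p := p) (x := x) (u := x ^ m * 1) (-((m : ℤ) * p)) m
    have e2 := PhiIter_mul_zpow (𝒢 := 𝒢) (p := p) (x := x) (u := 1) (m : ℤ) m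
    rw [PhiIter_pow_mul, ← hCP, mul_one, hyT] at e1
    rw [← hCP, one_mul] at e2
    rw [PhiIter_gcd, e1, e2, mul_gcd, hTm, zero_add]
  refine ⟨?_, ?_, ?_⟩
  · have := hinj m 0 _ (K_gcd hAm hDm) (by rw [TT_zero, mul_one]; exact le_gcd hCle1 hCle2) hD
    rw [this, TT_zero, mul_one]
  · have h0 : 0 ≤ 𝒢.inf C := le_infG_iff.2 (by simpa using hCpos)
    by_contra hne
    have h1 : 1 ≤ 𝒢.inf C := by omega
    rw [le_infG_iff, zpow_one] at h1
    have h2 := PhiIter_mono (p := p) (x := x) m h1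
    have e2 := PhiIter_mul_zpow (𝒢 := 𝒢) (p := p) (x := x) (u := 1) 1 m
    have e3 := hiter m 0
    rw [TT_zero, mul_one, zero_add] at e3
    rw [← hCP, one_mul, zpow_one] at e2
    rw [e2, e3, mul_le_mul_left_iff'] at h2
    have h3 : 𝒢.le 𝒢.Δ (TT S 1) :=
      TT_gcd hS hSw (n := m + 1) (by omega) (le_trans' h2 (TT_mono hS (by omega)))
        (by simpa using le_refl' 𝒢.Δ)
    have h4 : TT S 1 = S 0 := by simp [TT]
    rw [h4] at h3
    exact hSΔ 0 (le_antisymm' (hS 0).2 h3)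
  · have h0 : 𝒢.sup C ≤ m := supG_le_iff.2 hCle2
    by_contra hne
    cases m with
    | zero =>
      have : C = 1 := hCP
      have h1 : 0 ≤ 𝒢.inf C := le_infG_iff.2 (by simpa using hCpos)
      have h2 : (0 : ℤ) ≤ 𝒢.sup C := by unfold sup; omega
      simp at h0 hne
      omega
    | succ n =>
      have h1 : 𝒢.sup C ≤ n := by push_cast at h0 hne; omega
      rw [supG_le_iff] at h1
      have h2 := PhiIter_mono (p := p) (x := x) (n + 1) h1
      have e2 := PhiIter_mul_zpow (𝒢 := 𝒢) (p := p) (x := x) (u := 1) (n : ℤ) (n + 1)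
      have e3 := hiter (n + 1) 0
      rw [TT_zero, mul_one, zero_add] at e3
      rw [← hCP, one_mul] at e2
      rw [e2, e3, mul_le_mul_left_iff'] at h2
      have h3 := TT_gcd hS hSw (n := n + 1) (by omega) (le_refl' _) h2
      rw [TT_succ] at h3
      have h4 : 𝒢.le (S n) 1 := by
        rw [← mul_le_mul_left_iff' (TT S n), mul_one]; exact h3
      exact hS1 n (le_antisymm' h4 (one_le_iff.2 (hS n).1))

end Garside
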